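/- arXiv:2109.13882 — 2 statements merged into one kernel-verified Lean document; each statement's English description precedes it below -/
import Mathlib

section
/- Let R be a finite group, let r be a central involution of R, and let U be a proper subgroup of R containing r such that every element of U has order at most 2 and every element x ∈ R \ U satisfies x² = r. Then R is isomorphic either to C₄ × C₂^ℓ or to Q₈ × C₂^ℓ for some non-negative integer ℓ. -/
/-- A nonzero vector of a finite elementary abelian `2`-group has a complement. -/
theorem exists_hom_complement_of_two_nsmul {A : Type*} [AddCommGroup A] [Finite A]
    (hA : ∀ a : A, 2 • a = 0) {r : A} (hr : r ≠ 0) :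
    ∃ (l : ℕ) (g : (Fin l → ZMod 2) →+ A), Function.Injective g ∧ (∀ w, g w ≠ r) ∧
      ∀ a, ∃ w, a = g w ∨ a = r + g w := by
  let : Module (ZMod 2) A := AddCommGroup.zmodModule hA
  obtain ⟨W, hW⟩ := Submodule.exists_isCompl (Submodule.span (ZMod 2) {r})
  let e := (Module.finBasis (ZMod 2) W).equivFun
  refine ⟨_, (W.subtype ∘ₗ e.symm.toLinearMap).toAddMonoidHom, ?_, ?_, ?_⟩
  · exact Subtype.val_injective.comp e.symm.injective
  · intro w hw
    have h1 : r ∈ W := by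
      rw [← hw]
      exact (e.symm w).2
    exact hr (Submodule.disjoint_def.1 hW.disjoint r (Submodule.mem_span_singleton_self r) h1)
  · intro a
    have ha : a ∈ Submodule.span (ZMod 2) {r} ⊔ W := by
      rw [hW.sup_eq_top]
      trivial
    obtain ⟨y, hy, w, hw, rfl⟩ := Submodule.mem_sup.1 ha
    obtain ⟨k, rfl⟩ := Submodule.mem_span_singleton.1 hy
    refine ⟨e ⟨w, hw⟩, ?_⟩
    have hk : k = 0 ∨ k = 1 := by
      clear hy ha
      revert k
      decide
    rcases hk with rfl | rfl <;> simp

/-- A subgroup supplementing a central elementary abelian `2`-subgroup and meeting it in a group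
of order two is a direct factor with elementary abelian complement. -/
theorem exists_mulEquiv_prod_of_central {R H : Type*} [Group R] [Finite R] [Group H]
    {r : R} (hr1 : r ≠ 1) (U : Subgroup R) (hrU : r ∈ U) (hU2 : ∀ u ∈ U, u ^ 2 = 1)
    (hUc : ∀ u ∈ U, ∀ x, Commute x u) (φ : H →* R)
    (hφU : ∀ h, φ h ∈ U → h = 1 ∨ φ h = r) (hφr : ∃ h, φ h = r)
    (hφ : ∀ z, ∃ h, φ h * z ∈ U) :
    ∃ l : ℕ, Nonempty (R ≃* H × Multiplicative (Fin l → ZMod 2)) := by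
  let : CommGroup U :=
    { (inferInstance : Group U) with mul_comm := fun a b => Subtype.ext (hUc b b.2 a) }
  obtain ⟨l, g, hg, hgr, hgs⟩ := exists_hom_complement_of_two_nsmul (A := Additive U)
    (fun a => Subtype.ext (hU2 _ a.toMul.2)) (r := Additive.ofMul ⟨r, hrU⟩)
    (fun h => hr1 (congrArg Subtype.val h))
  let γ : Multiplicative (Fin l → ZMod 2) →* R :=
    U.subtype.comp (AddMonoidHom.toMultiplicativeLeft g)
  have hγU : ∀ w, γ w ∈ U := fun w => (g w.toAdd).toMul.2
  have hγ : Function.Injective γ := Subtype.val_injective.comp hg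
  have hγr : ∀ w, γ w ≠ r := fun w h => hgr w.toAdd (Subtype.ext h)
  have hγs : ∀ u ∈ U, ∃ w, u = γ w ∨ u = r * γ w := by
    intro u hu
    obtain ⟨w, hw⟩ := hgs (Additive.ofMul ⟨u, hu⟩)
    exact ⟨Multiplicative.ofAdd w, hw.imp (congrArg Subtype.val) (congrArg Subtype.val)⟩
  let ψ := φ.noncommCoprod γ (fun h w => hUc _ (hγU w) _)
  have hψ : ∀ h w, ψ (h, w) = φ h * γ w := fun h w => rfl
  refine ⟨l, ⟨(MulEquiv.ofBijective ψ ⟨?_, ?_⟩).symm⟩⟩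
  · rw [injective_iff_map_eq_one]
    rintro ⟨h, w⟩ hw
    rw [hψ] at hw
    have h1 : φ h = γ w⁻¹ := by rw [map_inv]; exact eq_inv_of_mul_eq_one_left hw
    rcases hφU h (h1 ▸ hγU _) with rfl | h2
    · rw [map_one, one_mul] at hw
      rw [(map_eq_one_iff γ hγ).1 hw]
      rfl
    · exact absurd (h1.symm.trans h2) (hγr _)
  · intro z
    obtain ⟨h, hh⟩ := hφ z
    obtain ⟨k, hk⟩ := hφr
    obtain ⟨w, hw | hw⟩ := hγs _ hh
    · exact ⟨(h⁻¹, w), by rw [hψ, ← hw, map_inv, inv_mul_cancel_left]⟩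
    · refine ⟨(h⁻¹ * k, w), ?_⟩
      rw [hψ, map_mul, hk, mul_assoc, ← hw, map_inv, inv_mul_cancel_left]

/-- The homomorphism from `ZMod n` sending `1` to an element of order dividing `n`. -/
def zmodPowHom {R : Type*} [Group R] (n : ℕ) [NeZero n] (x : R) (hx : x ^ n = 1) :
    Multiplicative (ZMod n) →* R :=
  MonoidHom.mk' (fun i => x ^ i.toAdd.val) fun i j => by
    rw [toAdd_mul, ZMod.val_add, ← pow_add]
    exact (pow_eq_pow_mod _ hx).symm

/-- The homomorphism from the quaternion group of order eight given by two elements satisfying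
its defining relations. -/
def quaternionLift {R : Type*} [Group R] (x y : R) (hx : x ^ 4 = 1) (hxy : y ^ 2 = x ^ 2)
    (h : SemiconjBy y x x⁻¹) : QuaternionGroup 2 →* R :=
  let c : Multiplicative (ZMod (2 * 2)) →* R := zmodPowHom (2 * 2) x hx
  have hc : ∀ i : ZMod (2 * 2),
      c (Multiplicative.ofAdd (-i)) * y = y * c (Multiplicative.ofAdd i) := fun i => by
    rw [ofAdd_neg, map_inv]
    change (x ^ i.val)⁻¹ * y = y * x ^ i.val
    rw [← inv_pow]
    exact (h.pow_right i.val).eq.symm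
  MonoidHom.mk' (fun q => match q with
    | .a i => c (Multiplicative.ofAdd i)
    | .xa i => y * c (Multiplicative.ofAdd i)) (by
    have hc2 : c (Multiplicative.ofAdd 2) = y * y := by
      exact hxy.symm.trans (pow_two y)
    rintro (i | i) (j | j)
    · simp only [QuaternionGroup.a_mul_a, ofAdd_add, map_mul]
    · simp only [QuaternionGroup.a_mul_xa]
      rw [← mul_assoc, ← neg_neg i, hc, mul_assoc, ← map_mul, ← ofAdd_add]
      congr 3
      ring
    · simp only [QuaternionGroup.xa_mul_a, ofAdd_add, map_mul, mul_assoc]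
    · simp only [QuaternionGroup.xa_mul_xa]
      have h1 := hc (-i)
      rw [neg_neg] at h1
      rw [mul_assoc, ← mul_assoc _ y, ← neg_neg i, hc, mul_assoc, ← mul_assoc, ← hc2,
        ← map_mul, ← map_mul, ← ofAdd_add, ← ofAdd_add]
      congr 2
      push_cast
      ring)

theorem stmt_16 {R : Type*} [Group R] [Finite R] (r : R)
    (hr2 : r ^ 2 = 1) (hr1 : r ≠ 1) (hrc : r ∈ Subgroup.center R)
    (U : Subgroup R) (hU : U ≠ ⊤) (hrU : r ∈ U)
    (hU2 : ∀ u ∈ U, u ^ 2 = 1)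
    (hout : ∀ x : R, x ∉ U → x ^ 2 = r) :
    (∃ ℓ : ℕ, Nonempty (R ≃* Multiplicative (ZMod 4 × (Fin ℓ → ZMod 2)))) ∨
    (∃ ℓ : ℕ, Nonempty (R ≃* QuaternionGroup 2 × Multiplicative (Fin ℓ → ZMod 2))) := by
  have hinvert : ∀ a b : R, b ∉ U → a * b ∉ U → SemiconjBy b a a⁻¹ := by
    intro a b hb hab
    have h1 := (hout _ hab).trans (hout _ hb).symm
    rw [pow_two, pow_two, ← mul_assoc, mul_left_inj] at h1
    rw [SemiconjBy, eq_inv_mul_iff_mul_eq, ← mul_assoc, h1]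
  have hUc : ∀ u ∈ U, ∀ x, Commute x u := by
    intro u hu x
    have hinv : u⁻¹ = u := inv_eq_of_mul_eq_one_left (by rw [← pow_two, hU2 u hu])
    by_cases hx : x ∈ U
    · have h1 := hU2 _ (U.mul_mem hx hu)
      have hxinv : x⁻¹ = x := inv_eq_of_mul_eq_one_left (by rw [← pow_two, hU2 x hx])
      have h2 : (x * u)⁻¹ = x * u := inv_eq_of_mul_eq_one_left (by rw [← pow_two, h1])
      rw [mul_inv_rev, hinv, hxinv] at h2
      exact h2.symm
    · have h1 := hinvert u x hx (by rwa [U.mul_mem_cancel_left hu])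
      rwa [hinv] at h1
  obtain ⟨x, hx⟩ : ∃ x, x ∉ U := by
    by_contra! h
    exact hU (U.eq_top_iff'.2 h)
  have hx2 := hout x hx
  have hx4 : x ^ 4 = 1 := by rw [show 4 = 2 * 2 from rfl, pow_mul, hx2, hr2]
  have hx3 : x ^ 3 ∉ U := by
    rwa [pow_succ, hx2, U.mul_mem_cancel_left hrU]
  by_cases hcase : ∀ z, z ∉ U → x * z ∈ U
  · left
    let φ := zmodPowHom 4 x hx4
    refine (exists_mulEquiv_prod_of_central hr1 U hrU hU2 hUc φ ?_ ?_ ?_).imp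
      fun l ⟨e⟩ => ⟨e.trans (MulEquiv.prodMultiplicative _ _).symm⟩
    · intro i hi
      change ZMod 4 at i
      change x ^ i.val ∈ U at hi
      change i = 0 ∨ x ^ i.val = r
      fin_cases i
      · exact Or.inl rfl
      · exact absurd ((pow_one x) ▸ hi) hx
      · exact Or.inr hx2
      · exact absurd hi hx3
    · exact ⟨Multiplicative.ofAdd 2, hx2⟩
    · intro z
      by_cases hz : z ∈ U
      · exact ⟨1, by simpa using hz⟩
      · refine ⟨Multiplicative.ofAdd 1, ?_⟩
        have h1 : φ (Multiplicative.ofAdd 1) = x := pow_one x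
        rw [h1]
        exact hcase z hz
  · right
    push Not at hcase
    obtain ⟨y, hy, hxy⟩ := hcase
    have hsc := hinvert x y hy hxy
    let φ := quaternionLift x y hx4 ((hout y hy).trans hx2.symm) hsc
    have hφa : ∀ i, φ (.a i) = x ^ i.val := fun _ => rfl
    have hφxa : ∀ i, φ (.xa i) = y * x ^ i.val := fun _ => rfl
    have hφ1 : φ (.a 1) = x := pow_one x
    have hφy : φ (.xa 0) = y := by rw [hφxa, ZMod.val_zero, pow_zero, mul_one]
    have hyx : y * x ∉ U := by
      have h1 : y * x = (x ^ 2)⁻¹ * (x * y) := by rw [hsc.eq]; group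
      rwa [h1, hx2, U.mul_mem_cancel_left (U.inv_mem hrU)]
    refine exists_mulEquiv_prod_of_central hr1 U hrU hU2 hUc φ ?_ ?_ ?_
    · rintro (i | i) hi
      · rw [hφa] at hi ⊢
        change ZMod 4 at i
        change x ^ i.val ∈ U at hi
        fin_cases i
        · exact Or.inl rfl
        · exact absurd ((pow_one x) ▸ hi) hx
        · exact Or.inr hx2
        · exact absurd hi hx3
      · rw [hφxa] at hi
        exfalso
        change ZMod 4 at i
        change y * x ^ i.val ∈ U at hi
        fin_cases i
        · change y * x ^ 0 ∈ U at hi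
          rw [pow_zero, mul_one] at hi
          exact hy hi
        · exact hyx ((pow_one x) ▸ hi)
        · change y * x ^ 2 ∈ U at hi
          rw [hx2, U.mul_mem_cancel_right hrU] at hi
          exact hy hi
        · change y * x ^ 3 ∈ U at hi
          rw [pow_succ', hx2, ← mul_assoc, U.mul_mem_cancel_right hrU] at hi
          exact hyx hi
    · exact ⟨.a 2, hx2⟩
    · intro z
      by_cases hz : z ∈ U
      · exact ⟨1, by simpa using hz⟩
      by_cases hxz : x * z ∈ U
      · exact ⟨.a 1, by rwa [hφ1]⟩
      by_cases hyz : y * z ∈ U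
      · exact ⟨.xa 0, by rwa [hφy]⟩
      refine ⟨.a 1 * .xa 0, ?_⟩
      rw [map_mul, hφ1, hφy]
      by_contra hxyz
      have h1 := hinvert _ _ hz hxyz
      have h2 := (hinvert _ _ hz hxz).mul_right (hinvert _ _ hz hyz)
      have h3 : (x * y)⁻¹ = x⁻¹ * y⁻¹ := mul_right_cancel (h1.eq.symm.trans h2.eq)
      have h4 : x * y = y * x := by
        rw [← inv_inj, h3, mul_inv_rev]
      have h5 : x = x⁻¹ := mul_right_cancel (h4.trans hsc.eq)
      apply hr1
      rw [← hx2, pow_two]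
      nth_rewrite 2 [h5]
      exact mul_inv_cancel x
end

section
/- Let R be a finite group and let G be a group of permutations of the underlying set of R that contains the right regular representation of R and acts transitively; let G₁ be the stabilizer in G of the identity element 1 ∈ R. If the number of elements of R lying in a G₁-orbit of cardinality at most 2 is at most (5/6)·|R|, then the number of inverse-closed subsets S ⊆ R that are unions of G₁-orbits (equivalently, inverse-closed and G₁-invariant) is at most 2^{c(R) − |R|/24}. -/
open MulAction

/-- Two points are equivalent when no member of the family `F` separates them. -/
def unseparatedSetoid {α : Type*} (F : Set (Set α)) : Setoid α where
  r x y := ∀ S ∈ F, x ∈ S ↔ y ∈ S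
  iseqv := ⟨fun _ _ _ => Iff.rfl, fun h S hS => (h S hS).symm,
    fun h h' S hS => (h S hS).trans (h' S hS)⟩

theorem ncard_le_two_pow_card_quotient {α : Type*} [Finite α] (F : Set (Set α)) :
    F.ncard ≤ 2 ^ Nat.card (Quotient (unseparatedSetoid F)) := by
  have hinj : Set.InjOn
      (fun S : Set α => (Quotient.mk (unseparatedSetoid F)) '' S) F := by
    intro S hS T hT hST
    have key : ∀ A ∈ F, ∀ B, Quotient.mk (unseparatedSetoid F) '' A =
        Quotient.mk (unseparatedSetoid F) '' B → B ⊆ A := by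
      intro A hA B hAB x hx
      have hx' : Quotient.mk (unseparatedSetoid F) x ∈ Quotient.mk (unseparatedSetoid F) '' A :=
        hAB ▸ Set.mem_image_of_mem _ hx
      obtain ⟨y, hy, hyx⟩ := hx'
      exact (Quotient.exact hyx A hA).1 hy
    exact (key T hT S hST.symm).antisymm (key S hS T hST)
  have : Nat.card (Set (Quotient (unseparatedSetoid F))) =
      2 ^ Nat.card (Quotient (unseparatedSetoid F)) := by
    have := Fintype.ofFinite (Quotient (unseparatedSetoid F))
    simp [Nat.card_eq_fintype_card]
  rw [← this, ← Set.ncard_univ]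
  exact Set.ncard_le_ncard_of_injOn _ (fun _ _ => Set.mem_univ _) hinj

theorem even_card_filter_sq_ne_one {R : Type*} [Group R] [DecidableEq R] (C : Finset R)
    (hC : ∀ x ∈ C, x⁻¹ ∈ C) : Even (C.filter fun x => x ^ 2 ≠ 1).card := by
  have h : ∑ x ∈ C.filter (fun x => x ^ 2 ≠ 1), (1 : ZMod 2) = 0 := by
    refine Finset.sum_involution (fun x _ => x⁻¹) (fun _ _ => by decide) ?_ ?_ ?_
    · intro x hx _ hxx
      refine (Finset.mem_filter.1 hx).2 ?_
      rw [sq]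
      nth_rewrite 1 [← hxx]
      exact inv_mul_cancel x
    · intro x hx
      obtain ⟨hx, hx'⟩ := Finset.mem_filter.1 hx
      exact Finset.mem_filter.2 ⟨hC x hx, by simpa using hx'⟩
    · intro x _
      exact inv_inv x
  rw [Finset.sum_const, nsmul_one] at h
  exact (ZMod.natCast_eq_zero_iff_even).1 h

theorem four_add_card_le_of_inv_mem {R : Type*} [Group R] [DecidableEq R] (C : Finset R)
    (hC : ∀ x ∈ C, x⁻¹ ∈ C) (hne : C.Nonempty) :
    4 + (if 3 ≤ C.card then C.card else 0) ≤
      2 * (C.card + (C.filter fun x => x ^ 2 = 1).card) := by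
  obtain ⟨k, hk⟩ := even_card_filter_sq_ne_one C hC
  have hsum := C.card_filter_add_card_filter_not (fun x => x ^ 2 = 1)
  have hpos := hne.card_pos
  simp only [ne_eq] at hk
  split_ifs <;> omega

theorem card_quotient_add_card_large_le {R : Type*} [Group R] [Fintype R] (s : Setoid R)
    (hs : ∀ x, s x x⁻¹) :
    4 * Nat.card (Quotient s) + {x : R | 3 ≤ {y | s x y}.ncard}.ncard ≤
      2 * (Nat.card R + {x : R | x ^ 2 = 1}.ncard) := by
  classical
  have hfiber (A : R → Prop) [DecidablePred A] : {x | A x}.ncard = ∑ q : Quotient s,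
      ((Finset.univ.filter fun x => (Quotient.mk s x) = q).filter A).card := by
    rw [Set.ncard_eq_toFinset_card', Finset.card_eq_sum_card_fiberwise
      (f := Quotient.mk s) (t := Finset.univ) (fun _ _ => by simp)]
    refine Finset.sum_congr rfl fun q _ => congrArg _ ?_
    ext x
    simp [and_comm]
  have hR : Nat.card R = ∑ q : Quotient s,
      (Finset.univ.filter fun x => (Quotient.mk s x) = q).card := by
    simpa using hfiber (fun _ => True)
  rw [hR, hfiber, hfiber, Nat.card_eq_fintype_card, Fintype.card, mul_comm, ← smul_eq_mul,
    ← Finset.sum_const, ← Finset.sum_add_distrib, ← Finset.sum_add_distrib, Finset.mul_sum]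
  refine Finset.sum_le_sum fun q _ => ?_
  induction q using Quotient.inductionOn with | h a => ?_
  refine le_trans ?_ (four_add_card_le_of_inv_mem _ ?_ ⟨a, by simp⟩)
  · gcongr
    split_ifs with h
    · exact Finset.card_filter_le _ _
    · rw [Nat.le_zero, Finset.card_eq_zero, Finset.filter_eq_empty_iff]
      intro x hx hx'
      refine h ?_
      rw [Finset.mem_filter] at hx
      rw [Set.ncard_eq_toFinset_card'] at hx'
      convert hx' using 2
      ext y
      simp only [Finset.mem_filter, Finset.mem_univ, true_and, Set.mem_toFinset, Set.mem_ofPred_eq]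
      rw [← hx.2, Quotient.eq]
      exact ⟨s.symm', s.symm'⟩
  · intro x hx
    rw [Finset.mem_filter] at hx ⊢
    exact ⟨Finset.mem_univ _, (Quotient.sound (s.symm' (hs x))).trans hx.2⟩

theorem stmt_17 {R : Type*} [Group R] [Finite R] (G : Subgroup (Equiv.Perm R))
    (hreg : ∀ r : R, Equiv.mulRight r ∈ G)
    (htrans : MulAction.IsPretransitive G R)
    (h : ({x : R | Nat.card (orbit (stabilizer G (1 : R)) x) ≤ 2}.ncard : ℚ)
      ≤ 5 / 6 * Nat.card R) :
    ({S : Set R | S⁻¹ = S ∧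
        ∀ g ∈ stabilizer G (1 : R), (fun x : R => (g : Equiv.Perm R) x) '' S = S}.ncard : ℝ)
      ≤ 2 ^ (((Nat.card R : ℝ) + ({x : R | x ^ 2 = 1}.ncard : ℝ)) / 2
          - (Nat.card R : ℝ) / 24) := by
  have := Fintype.ofFinite R
  set F := {S : Set R | S⁻¹ = S ∧
    ∀ g ∈ stabilizer G (1 : R), (fun x : R => (g : Equiv.Perm R) x) '' S = S}
  have hinv (x : R) : unseparatedSetoid F x x⁻¹ := by
    intro S hS
    change x ∈ S ↔ x ∈ S⁻¹
    rw [hS.1]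
  have horb (x : R) : orbit (stabilizer G (1 : R)) x ⊆ {y | unseparatedSetoid F x y} := by
    rintro _ ⟨g, rfl⟩ S hS
    have hg := hS.2 g g.2
    change x ∈ S ↔ ((g : G) : Equiv.Perm R) x ∈ S
    nth_rewrite 2 [← hg]
    exact (((g : G) : Equiv.Perm R).injective.mem_set_image).symm
  have hlarge : Nat.card R ≤ {x : R | Nat.card (orbit (stabilizer G (1 : R)) x) ≤ 2}.ncard +
      {x : R | 3 ≤ {y | unseparatedSetoid F x y}.ncard}.ncard := by
    rw [← Set.ncard_add_ncard_compl {x : R | Nat.card (orbit (stabilizer G (1 : R)) x) ≤ 2}]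
    gcongr
    · exact Set.toFinite _
    · intro x hx
      have hx' : ¬ (orbit (stabilizer G (1 : R)) x).ncard ≤ 2 := hx
      have := Set.ncard_le_ncard (horb x)
      change 3 ≤ _
      omega
  have hcount := card_quotient_add_card_large_le (unseparatedSetoid F) hinv
  have hF' : (F.ncard : ℝ) ≤ 2 ^ (Nat.card (Quotient (unseparatedSetoid F)) : ℝ) := by
    rw [Real.rpow_natCast]
    exact_mod_cast ncard_le_two_pow_card_quotient F
  refine hF'.trans (Real.rpow_le_rpow_of_exponent_le one_le_two ?_)
  have hsmall : 6 * {x : R | Nat.card (orbit (stabilizer G (1 : R)) x) ≤ 2}.ncard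
      ≤ 5 * Nat.card R := by
    rw [← Nat.cast_le (α := ℚ), Nat.cast_mul, Nat.cast_mul]
    push_cast
    linarith
  have hbound : 24 * Nat.card (Quotient (unseparatedSetoid F)) + Nat.card R ≤
      12 * (Nat.card R + {x : R | x ^ 2 = 1}.ncard) := by
    omega
  rw [← Nat.cast_le (α := ℝ), Nat.cast_add, Nat.cast_mul, Nat.cast_mul, Nat.cast_add] at hbound
  push_cast at hbound
  linarith
end
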